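/- arXiv:2309.00515 — 6 statements merged into one kernel-verified Lean document; each statement's English description precedes it below -/
import Mathlib

section
/- Let (x_k) and (y_k) be sequences in X with x_k → x ∈ X and y_k → y ∈ X. If T_M(y_k, x_k) < ∞ for all k ∈ ℕ, then T_M(y_k, x_k) → T_M(y, x) as k → ∞ (in particular T_M(y,x) < ∞). -/
open Filter Topology Set
open scoped ENNReal

variable {X : Type*} [NormedAddCommGroup X] [NormedSpace ℝ X]

/-- The directional minimal time function `T_M(y,x) = inf {t ≥ 0 | ∃ m ∈ M, x = y + t•m}`,
with values in `[0,∞]` and `inf ∅ = ∞`. -/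
noncomputable def minTime (M : Set X) (y x : X) : ℝ≥0∞ :=
  sInf {t : ℝ≥0∞ | ∃ r : ℝ, 0 ≤ r ∧ t = ENNReal.ofReal r ∧ ∃ m ∈ M, x = y + r • m}

/-- The cone generated by `M`: `cone(M) = {t•m | t ≥ 0, m ∈ M}`. -/
def coneOf (M : Set X) : Set X := {p : X | ∃ t : ℝ, 0 ≤ t ∧ ∃ m ∈ M, p = t • m}

/-- `D_x := A ∩ dom T_M(·,x)`. -/
def Dset (M A : Set X) (x : X) : Set X := A ∩ {y : X | minTime M y x ≠ ⊤}

theorem minTime_aux1 (M : Set X) (hM : M ⊆ Metric.sphere (0 : X) 1) (y x : X) (r : ℝ)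
    (hr : 0 ≤ r) (m : X) (hm : m ∈ M) (h : x = y + r • m) : r = ‖x - y‖ := by
  have h1 : ‖m‖ = 1 := by simpa using hM hm
  rw [h, add_sub_cancel_left, norm_smul, h1, Real.norm_of_nonneg hr, mul_one]

theorem minTime_aux2 (M : Set X) (y x : X) (h : minTime M y x ≠ ⊤) :
    ∃ r : ℝ, 0 ≤ r ∧ ∃ m ∈ M, x = y + r • m := by
  by_contra hc
  apply h
  unfold minTime
  rw [sInf_eq_top]
  rintro t ⟨r, hr, -, hm⟩
  exact absurd ⟨r, hr, hm⟩ hc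

theorem minTime_aux3 (M : Set X) (hM : M ⊆ Metric.sphere (0 : X) 1) (y x : X) (m : X)
    (hm : m ∈ M) (h : x = y + ‖x - y‖ • m) : minTime M y x = ENNReal.ofReal ‖x - y‖ := by
  apply le_antisymm
  · exact sInf_le ⟨_, norm_nonneg _, rfl, m, hm, h⟩
  · apply le_sInf
    rintro t ⟨r, hr, rfl, m', hm', h'⟩
    rw [← minTime_aux1 M hM y x r hr m' hm' h']

/-- Lemma 2.2: if `x_k → x`, `y_k → y` and `T_M(y_k,x_k) < ∞` for all `k`,
then `T_M(y,x) < ∞` and `T_M(y_k,x_k) → T_M(y,x)`. -/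
theorem minTime_tendsto [CompleteSpace X]
    (M : Set X) (hMne : M.Nonempty) (hMcl : IsClosed M)
    (hMsph : M ⊆ Metric.sphere (0 : X) 1) (hMcone : Convex ℝ (coneOf M))
    (x y : X) (xk yk : ℕ → X)
    (hx : Tendsto xk atTop (𝓝 x)) (hy : Tendsto yk atTop (𝓝 y))
    (hfin : ∀ k : ℕ, minTime M (yk k) (xk k) ≠ ⊤) :
    minTime M y x ≠ ⊤ ∧
      Tendsto (fun k => minTime M (yk k) (xk k)) atTop (𝓝 (minTime M y x)) := by
  have key : ∀ k, ∃ m ∈ M, xk k = yk k + ‖xk k - yk k‖ • m := by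
    intro k
    obtain ⟨r, hr, m, hm, h⟩ := minTime_aux2 M _ _ (hfin k)
    have := minTime_aux1 M hMsph _ _ r hr m hm h
    exact ⟨m, hm, this ▸ h⟩
  choose m hm hmk using key
  have hv : Tendsto (fun k => xk k - yk k) atTop (𝓝 (x - y)) := hx.sub hy
  have hlim : ∃ m ∈ M, x = y + ‖x - y‖ • m := by
    by_cases h0 : x - y = 0
    · obtain ⟨a, ha⟩ := hMne
      exact ⟨a, ha, by rw [h0]; simpa using sub_eq_zero.mp h0⟩
    · have hn : ‖x - y‖ ≠ 0 := norm_ne_zero_iff.mpr h0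
      have ht : Tendsto (fun k => ‖xk k - yk k‖⁻¹ • (xk k - yk k)) atTop
          (𝓝 (‖x - y‖⁻¹ • (x - y))) := (hv.norm.inv₀ hn).smul hv
      refine ⟨‖x - y‖⁻¹ • (x - y), hMcl.mem_of_tendsto ht ?_, ?_⟩
      · filter_upwards [hv.norm.eventually_ne hn] with k hk
        have h1 : xk k - yk k = ‖xk k - yk k‖ • m k := sub_eq_iff_eq_add'.mpr (hmk k)
        have h2 : ‖xk k - yk k‖⁻¹ • (xk k - yk k) = m k := by
          rw [inv_smul_eq_iff₀ hk]; exact h1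
        rw [h2]; exact hm k
      · rw [smul_inv_smul₀ hn]; abel
  obtain ⟨a, ha, hxa⟩ := hlim
  rw [minTime_aux3 M hMsph y x a ha hxa]
  refine ⟨ENNReal.ofReal_ne_top, ?_⟩
  simp_rw [fun k => minTime_aux3 M hMsph (yk k) (xk k) (m k) (hm k) (hmk k)]
  exact ENNReal.tendsto_ofReal hv.norm
end

section
/- (Furi–Vignoli type criterion.) Suppose f is lower semicontinuous on A. Then problem (MP) is directionally Tykhonov well-posed with respect to M if and only if there exists x̄ ∈ A such that f is bounded from below on D_x̄ and diam(L(x̄, ε)) → 0 as ε → 0, where L(x̄, ε) := {y ∈ D_x̄ : f(y) ≤ inf_{x ∈ D_x̄} f(x) + ε} for ε > 0. -/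
open Filter Topology Set
open scoped ENNReal

variable {X : Type*} [NormedAddCommGroup X] [NormedSpace ℝ X]

/-- Problem (MP) (minimize `f` over `A`) is directionally Tykhonov well-posed w.r.t. `M`:
there is `x̄ ∈ A` which is the unique global directional minimum point of `f` on `D_x̄`,
and every sequence in `D_x̄` whose `f`-values tend to `f(x̄)` satisfies `T_M(x_k,x̄) → 0`. -/
def DirTykhonovWP (M A : Set X) (f : X → EReal) : Prop :=
  ∃ xb ∈ A, (∀ x ∈ Dset M A xb, f xb ≤ f x) ∧
    (∀ x ∈ Dset M A xb, f x = f xb → x = xb) ∧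
    ∀ u : ℕ → X, (∀ k, u k ∈ Dset M A xb) →
      Tendsto (fun k => f (u k)) atTop (𝓝 (f xb)) →
      Tendsto (fun k => minTime M (u k) xb) atTop (𝓝 0)


theorem minTime_eq (M : Set X) (hMsph : M ⊆ Metric.sphere (0 : X) 1) {y x : X}
    (h : x - y ∈ coneOf M) : minTime M y x = edist y x := by
  obtain ⟨t, ht, m, hm, hp⟩ := h
  have key : ∀ r : ℝ, 0 ≤ r → ∀ m ∈ M, x = y + r • m → ENNReal.ofReal r = edist y x := by
    intro r hr m hm hx
    have h1 : ‖m‖ = 1 := by simpa using hMsph hm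
    rw [edist_dist, dist_comm, dist_eq_norm, hx]
    simp [norm_smul, h1, abs_of_nonneg hr]
  apply le_antisymm
  · apply sInf_le
    have hx : x = y + t • m := by rw [← hp]; abel
    exact ⟨t, ht, (key t ht m hm hx).symm, m, hm, hx⟩
  · apply le_sInf
    rintro s ⟨r, hr, rfl, m', hm', hx⟩
    exact (key r hr m' hm' hx).ge

theorem minTime_ne_top_iff (M : Set X) (hMsph : M ⊆ Metric.sphere (0 : X) 1) {y x : X} :
    minTime M y x ≠ ⊤ ↔ x - y ∈ coneOf M := by
  constructor
  · intro h
    by_contra hc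
    apply h
    unfold minTime
    rw [sInf_eq_top]
    rintro s ⟨r, hr, rfl, m, hm, hx⟩
    exact absurd ⟨r, hr, m, hm, by rw [hx]; abel⟩ hc
  · intro h
    rw [minTime_eq M hMsph h]
    exact edist_ne_top _ _

theorem coneOf_isClosed (M : Set X) (hMne : M.Nonempty) (hMcl : IsClosed M)
    (hMsph : M ⊆ Metric.sphere (0 : X) 1) : IsClosed (coneOf M) := by
  apply IsSeqClosed.isClosed
  intro u p hu hup
  by_cases hp : p = 0
  · obtain ⟨m, hm⟩ := hMne
    exact ⟨0, le_rfl, m, hm, by simp [hp]⟩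
  have hn : ‖p‖ ≠ 0 := by simpa using hp
  have h1 : Tendsto (fun k => ‖u k‖⁻¹ • u k) atTop (𝓝 (‖p‖⁻¹ • p)) :=
    (hup.norm.inv₀ hn).smul hup
  have h2 : ∀ᶠ k in atTop, u k ≠ 0 := hup.eventually_ne hp
  have h3 : ‖p‖⁻¹ • p ∈ M := by
    apply hMcl.mem_of_tendsto h1
    filter_upwards [h2] with k hk
    obtain ⟨t, ht, m, hm, hpm⟩ := hu k
    have hm1 : ‖m‖ = 1 := by simpa using hMsph hm
    have ht0 : t ≠ 0 := by
      rintro rfl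
      simp [hpm] at hk
    have : ‖u k‖⁻¹ • u k = m := by
      rw [hpm, norm_smul, hm1, Real.norm_of_nonneg ht, mul_one, smul_smul,
        inv_mul_cancel₀ ht0, one_smul]
    rwa [this]
  exact ⟨‖p‖, norm_nonneg _, _, h3, by rw [smul_smul, mul_inv_cancel₀ hn, one_smul]⟩

theorem coneOf_add (M : Set X) (hMcone : Convex ℝ (coneOf M)) {p q : X}
    (hp : p ∈ coneOf M) (hq : q ∈ coneOf M) : p + q ∈ coneOf M := by
  have h := hMcone hp hq (a := 1/2) (b := 1/2) (by norm_num) (by norm_num) (by norm_num)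
  obtain ⟨t, ht, m, hm, h⟩ := h
  refine ⟨2 * t, by positivity, m, hm, ?_⟩
  rw [mul_smul, ← h, ← smul_add, smul_smul]
  norm_num

theorem ereal_tendsto_aux (m : EReal) :
    Tendsto (fun k : ℕ => m + (((1 : ℝ) / ((k : ℝ) + 1) : ℝ) : EReal)) atTop (𝓝 m) := by
  have h0 : Tendsto (fun k : ℕ => (((1 : ℝ) / ((k : ℝ) + 1) : ℝ) : EReal)) atTop
      (𝓝 ((0 : ℝ) : EReal)) :=
    (continuous_coe_real_ereal.tendsto 0).comp tendsto_one_div_add_atTop_nhds_zero_nat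
  have h1 : ContinuousAt (fun p : EReal × EReal => p.1 + p.2) (m, ((0 : ℝ) : EReal)) :=
    EReal.continuousAt_add (Or.inr (EReal.coe_ne_bot _)) (Or.inr (EReal.coe_ne_top _))
  have h2 := h1.tendsto.comp ((tendsto_const_nhds (x := m)).prodMk_nhds h0)
  simpa [Function.comp_def] using h2

theorem ereal_lt_aux {m : EReal} (hm : m ≠ ⊥) (hm' : m ≠ ⊤) {ε : ℝ} (hε : 0 < ε) :
    m < m + (ε : EReal) := by
  lift m to ℝ using ⟨hm', hm⟩
  rw [← EReal.coe_add, EReal.coe_lt_coe_iff]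
  linarith

/-- Theorem 3.1, Furi–Vignoli type criterion. -/
theorem dirTykhonovWP_iff_diam_levelSets [CompleteSpace X]
    (M : Set X) (hMne : M.Nonempty) (hMcl : IsClosed M)
    (hMsph : M ⊆ Metric.sphere (0 : X) 1) (hMcone : Convex ℝ (coneOf M))
    (A : Set X) (hAne : A.Nonempty) (hAcl : IsClosed A)
    (f : X → EReal) (hbot : ∀ x, f x ≠ ⊥) (hproper : ∃ x ∈ A, f x ≠ ⊤)
    (hlsc : LowerSemicontinuousOn f A) :
    DirTykhonovWP M A f ↔
      ∃ xb ∈ A, (∃ b : ℝ, ∀ x ∈ Dset M A xb, (b : EReal) ≤ f x) ∧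
        Tendsto (fun ε : ℝ =>
            EMetric.diam {y ∈ Dset M A xb | f y ≤ sInf (f '' Dset M A xb) + (ε : EReal)})
          (𝓝[>] 0) (𝓝 0) := by
  have hmem : ∀ x y : X, y ∈ Dset M A x ↔ y ∈ A ∧ x - y ∈ coneOf M := fun x y =>
    and_congr_right fun _ => minTime_ne_top_iff M hMsph
  have h0 : (0 : X) ∈ coneOf M := by
    obtain ⟨m, hm⟩ := hMne
    exact ⟨0, le_rfl, m, hm, by simp⟩
  have hself : ∀ x ∈ A, x ∈ Dset M A x := fun x hx => (hmem x x).2 ⟨hx, by simpa using h0⟩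
  constructor
  · rintro ⟨xb, hxb, hmin, -, hseq⟩
    refine ⟨xb, hxb, ?_, ?_⟩
    · obtain ⟨b, -, hb⟩ := EReal.lt_iff_exists_real_btwn.1 (bot_lt_iff_ne_bot.2 (hbot xb))
      exact ⟨b, fun x hx => hb.le.trans (hmin x hx)⟩
    have hinf : sInf (f '' Dset M A xb) = f xb := by
      apply le_antisymm (sInf_le (mem_image_of_mem f (hself xb hxb)))
      apply le_sInf
      rintro _ ⟨x, hx, rfl⟩
      exact hmin x hx
    rw [hinf, ENNReal.tendsto_nhds_zero]
    intro δ hδ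
    have hδ2 : 0 < δ / 2 := ENNReal.half_pos hδ.ne'
    have hex : ∃ N : ℕ, ∀ y ∈ Dset M A xb,
        f y ≤ f xb + (((1 : ℝ) / ((N : ℝ) + 1) : ℝ) : EReal) → edist y xb ≤ δ / 2 := by
      by_contra! hc
      choose u hu1 hu2 hu3 using hc
      have ht := hseq u hu1 (tendsto_of_tendsto_of_tendsto_of_le_of_le tendsto_const_nhds
        (ereal_tendsto_aux (f xb)) (fun k => hmin _ (hu1 k)) hu2)
      rw [ENNReal.tendsto_nhds_zero] at ht
      obtain ⟨k, hk⟩ := (ht _ hδ2).exists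
      rw [minTime_eq M hMsph ((hmem _ _).1 (hu1 k)).2] at hk
      exact absurd hk (hu3 k).not_ge
    obtain ⟨N, hN⟩ := hex
    have hNpos : (0 : ℝ) < 1 / ((N : ℝ) + 1) := by positivity
    filter_upwards [Ioo_mem_nhdsGT hNpos] with ε hε
    apply Metric.ediam_le
    have hall : ∀ y ∈ {y ∈ Dset M A xb | f y ≤ f xb + (ε : EReal)}, edist y xb ≤ δ / 2 := by
      rintro y ⟨hy, hfy⟩
      refine hN y hy (hfy.trans ?_)
      gcongr
      exact hε.2.le
    intro y hy z hz
    calc edist y z ≤ edist y xb + edist z xb := edist_triangle_right _ _ _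
      _ ≤ δ / 2 + δ / 2 := add_le_add (hall y hy) (hall z hz)
      _ = δ := ENNReal.add_halves δ
  · rintro ⟨xb, hxb, ⟨b, hb⟩, hdiam⟩
    set D := Dset M A xb with hD
    set m := sInf (f '' D) with hm
    have hmle : ∀ x ∈ D, m ≤ f x := fun x hx => sInf_le ⟨x, hx, rfl⟩
    have hmbot : m ≠ ⊥ := by
      have : (b : EReal) ≤ m := by
        apply le_sInf
        rintro _ ⟨x, hx, rfl⟩
        exact hb x hx
      intro h
      rw [h, le_bot_iff] at this
      exact EReal.coe_ne_bot b this
    have hne : ∀ ε : ℝ, 0 < ε → ∃ y ∈ D, f y ≤ m + (ε : EReal) := by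
      intro ε hε
      by_cases ht : m = ⊤
      · refine ⟨xb, hself xb hxb, ?_⟩
        rw [ht, EReal.top_add_coe]
        exact le_top
      · obtain ⟨_, ⟨y, hy, rfl⟩, hlt⟩ := sInf_lt_iff.1 (ereal_lt_aux hmbot ht hε)
        exact ⟨y, hy, hlt.le⟩
    have hpos : ∀ k : ℕ, (0 : ℝ) < 1 / ((k : ℝ) + 1) := fun k => by positivity
    choose u huD hu using fun k : ℕ => hne _ (hpos k)
    have hcauchy : CauchySeq u := by
      rw [EMetric.cauchySeq_iff_le_tendsto_0]
      refine ⟨_, ?_, hdiam.comp (tendsto_nhdsWithin_iff.2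
        ⟨tendsto_one_div_add_atTop_nhds_zero_nat, Eventually.of_forall hpos⟩)⟩
      have hin : ∀ n N : ℕ, N ≤ n →
          u n ∈ {y ∈ D | f y ≤ m + (((1 : ℝ) / ((N : ℝ) + 1) : ℝ) : EReal)} := by
        intro n N h
        refine ⟨huD n, (hu n).trans ?_⟩
        gcongr
      intro n k N hn hk
      exact Metric.edist_le_ediam_of_mem (hin n N hn) (hin k N hk)
    obtain ⟨xh, hxh⟩ := cauchySeq_tendsto_of_complete hcauchy
    have hxA : xh ∈ A := hAcl.mem_of_tendsto hxh
      (Eventually.of_forall fun k => ((hmem _ _).1 (huD k)).1)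
    have hxcone : xb - xh ∈ coneOf M :=
      (coneOf_isClosed M hMne hMcl hMsph).mem_of_tendsto (tendsto_const_nhds.sub hxh)
        (Eventually.of_forall fun k => ((hmem _ _).1 (huD k)).2)
    have hxD : xh ∈ D := (hmem _ _).2 ⟨hxA, hxcone⟩
    have hfx : f xh = m := by
      apply le_antisymm _ (hmle xh hxD)
      by_contra! hlt
      obtain ⟨c, hc1, hc2⟩ := exists_between hlt
      have h1 : ∀ᶠ k in atTop, c < f (u k) :=
        (tendsto_nhdsWithin_iff.2 ⟨hxh, Eventually.of_forall fun k =>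
          ((hmem _ _).1 (huD k)).1⟩).eventually (hlsc xh hxA c hc2)
      have h2 : c ≤ m := ge_of_tendsto (ereal_tendsto_aux m)
        (h1.mono fun k hk => hk.le.trans (hu k))
      exact absurd hc1 h2.not_gt
    have hsub : ∀ y ∈ Dset M A xh, y ∈ D := by
      intro y hy
      rw [hmem] at hy
      refine (hmem _ _).2 ⟨hy.1, ?_⟩
      have := coneOf_add M hMcone hxcone hy.2
      rwa [sub_add_sub_cancel] at this
    have hseq : ∀ v : ℕ → X, (∀ k, v k ∈ Dset M A xh) →
      Tendsto (fun k => f (v k)) atTop (𝓝 (f xh)) →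
      Tendsto (fun k => minTime M (v k) xh) atTop (𝓝 0) := by
      intro v hv hfv
      rw [ENNReal.tendsto_nhds_zero] at hdiam ⊢
      intro δ hδ
      obtain ⟨ε, hε, hε0⟩ := ((hdiam δ hδ).and self_mem_nhdsWithin).exists
      have hε0 : 0 < ε := hε0
      have hev : ∀ᶠ k in atTop, f (v k) ≤ m + (ε : EReal) := by
        by_cases ht : m = ⊤
        · rw [ht, EReal.top_add_coe]
          exact Eventually.of_forall fun _ => le_top
        · rw [hfx] at hfv
          exact (hfv.eventually_lt_const (ereal_lt_aux hmbot ht hε0)).mono fun _ h => h.le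
      filter_upwards [hev] with k hk
      rw [minTime_eq M hMsph ((hmem _ _).1 (hv k)).2]
      have hvL : v k ∈ {y ∈ D | f y ≤ m + (ε : EReal)} := ⟨hsub _ (hv k), hk⟩
      suffices hxL : xh ∈ {y ∈ D | f y ≤ m + (ε : EReal)} from
        le_trans (Metric.edist_le_ediam_of_mem hvL hxL) hε
      refine ⟨hxD, ?_⟩
      rw [hfx]
      by_cases ht : m = ⊤
      · rw [ht, EReal.top_add_coe]
      · exact (ereal_lt_aux hmbot ht hε0).le
    refine ⟨xh, hxA, fun x hx => hfx.le.trans (hmle x (hsub x hx)), ?_, hseq⟩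
    intro x hx hfxx
    have h := hseq (fun _ => x) (fun _ => hx) (by rw [hfxx]; exact tendsto_const_nhds)
    rw [minTime_eq M hMsph ((hmem _ _).1 hx).2] at h
    exact edist_eq_zero.1 (tendsto_nhds_unique tendsto_const_nhds h)
end

section
/- (Directional Ekeland variational principle.) Suppose f is lower semicontinuous on A and there exists x̄ ∈ A such that f is bounded from below on D_x̄. Then for every ε > 0 and every x₀ ∈ L(x̄, ε) := {y ∈ D_x̄ : f(y) ≤ inf_{x ∈ D_x̄} f(x) + ε}, there exists x_ε ∈ D_x̄ such that: (i) T_M(x₀, x_ε) ≤ √ε; (ii) f(x_ε) + √ε · T_M(x₀, x_ε) ≤ f(x₀); and (iii) f(x_ε) ≤ f(y) + √ε · T_M(x_ε, y) for all y ∈ D_x̄. -/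
open Filter Topology Set
open scoped ENNReal

variable {X : Type*} [NormedAddCommGroup X] [NormedSpace ℝ X]

lemma ek_aux [CompleteSpace X] (F : Set X) (hF : IsClosed F) (g : X → ℝ) (b : ℝ)
    (hb : ∀ x ∈ F, b ≤ g x) (hl : LowerSemicontinuousOn g F) (C : Set X) (hC : IsClosed C)
    (h0 : (0 : X) ∈ C) (hadd : ∀ x ∈ C, ∀ y ∈ C, x + y ∈ C) (c : ℝ) (hc : 0 < c)
    (x0 : X) (hx0 : x0 ∈ F) :
    ∃ xe ∈ F, xe - x0 ∈ C ∧ g xe + c * ‖xe - x0‖ ≤ g x0 ∧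
      ∀ y ∈ F, y - xe ∈ C → g y + c * ‖y - xe‖ ≤ g xe → y = xe := by
  let S : X → X → Prop := fun x z => z ∈ F ∧ z - x ∈ C ∧ g z + c * ‖z - x‖ ≤ g x
  have hSr : ∀ x ∈ F, S x x := fun x hx => ⟨hx, by simpa using h0, by simp⟩
  have hSt : ∀ x y z, S x y → S y z → S x z := by
    rintro x y z ⟨_, h1, h2⟩ ⟨h3, h4, h5⟩
    refine ⟨h3, ?_, ?_⟩
    · have := hadd _ h4 _ h1
      simpa using this
    · have h6 : ‖z - x‖ ≤ ‖z - y‖ + ‖y - x‖ := norm_sub_le_norm_sub_add_norm_sub z y x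
      nlinarith
  have hstep : ∀ (n : ℕ) (x : F), ∃ z : F, S x z ∧ ∀ y, S x y → g z ≤ g y + (1/2 : ℝ)^n := by
    intro n x
    have hne : (g '' {y | S x y}).Nonempty := ⟨_, x, hSr x x.2, rfl⟩
    have hbd : BddBelow (g '' {y | S x y}) := by
      refine ⟨b, ?_⟩
      rintro _ ⟨y, hy, rfl⟩
      exact hb y hy.1
    obtain ⟨_, ⟨z, hz, rfl⟩, hlt⟩ := exists_lt_of_csInf_lt hne
      (lt_add_of_pos_right (sInf (g '' {y | S x y})) (by positivity : (0 : ℝ) < (1/2 : ℝ)^n))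
    refine ⟨⟨z, hz.1⟩, hz, fun y hy => ?_⟩
    have := csInf_le hbd ⟨y, hy, rfl⟩
    simp only at *
    linarith
  choose step hs1 hs2 using hstep
  obtain ⟨u, hu0, hu⟩ : ∃ u : ℕ → F, u 0 = ⟨x0, hx0⟩ ∧ ∀ n, u (n+1) = step n (u n) :=
    ⟨fun n => Nat.rec ⟨x0, hx0⟩ (fun n x => step n x) n, rfl, fun n => rfl⟩
  have hS : ∀ n m : ℕ, n ≤ m → S (u n).1 (u m).1 := by
    intro n m h
    induction m, h using Nat.le_induction with
    | base => exact hSr _ (u n).2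
    | succ m _ ih => exact hSt _ _ _ ih (by rw [hu]; exact hs1 m (u m))
  have hanti : Antitone (fun n => g (u n)) := by
    intro n m h
    have := (hS n m h).2.2
    have h2 : 0 ≤ c * ‖(u m : X) - u n‖ := by positivity
    simp only
    linarith
  have hbd : BddBelow (range (fun n => g (u n))) := by
    refine ⟨b, ?_⟩
    rintro _ ⟨n, rfl⟩
    exact hb _ (u n).2
  obtain ⟨l, hl1⟩ : ∃ l, Tendsto (fun n => g (u n)) atTop (𝓝 l) :=
    ⟨_, tendsto_atTop_ciInf hanti hbd⟩
  have hlle : ∀ n, l ≤ g (u n) := fun n => hanti.le_of_tendsto hl1 n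
  have hcau : CauchySeq (fun n => (u n : X)) := by
    refine cauchySeq_of_le_tendsto_0' (fun n => (g (u n) - l) / c) ?_ ?_
    · intro n m h
      rw [dist_comm, dist_eq_norm, le_div_iff₀ hc]
      have := (hS n m h).2.2
      have := hlle m
      nlinarith
    · have := (hl1.sub_const l).div_const c
      simpa using this
  obtain ⟨xe, hxe⟩ := cauchySeq_tendsto_of_complete hcau
  have hxF : xe ∈ F := hF.mem_of_tendsto hxe (Eventually.of_forall fun n => (u n).2)
  have hgl : g xe ≤ l := by
    refine le_of_forall_lt fun a ha => ?_
    obtain ⟨a', ha1, ha2⟩ := exists_between ha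
    refine lt_of_lt_of_le ha1 ?_
    have h1 : Tendsto (fun n => (u n : X)) atTop (𝓝[F] xe) :=
      tendsto_nhdsWithin_iff.2 ⟨hxe, Eventually.of_forall fun n => (u n).2⟩
    exact ge_of_tendsto hl1 ((h1.eventually (hl xe hxF a' ha2)).mono fun _ h => h.le)
  have hSx : ∀ n, S (u n) xe := by
    intro n
    refine ⟨hxF, ?_, ?_⟩
    · exact hC.mem_of_tendsto (hxe.sub_const _)
        ((eventually_ge_atTop n).mono fun m hm => (hS n m hm).2.1)
    · have h1 : l + c * ‖xe - u n‖ ≤ g (u n) :=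
        le_of_tendsto (hl1.add ((hxe.sub_const _).norm.const_mul c))
          ((eventually_ge_atTop n).mono fun m hm => (hS n m hm).2.2)
      linarith
  have hS0 := hSx 0
  rw [hu0] at hS0
  refine ⟨xe, hxF, hS0.2.1, hS0.2.2, ?_⟩
  intro y hy hyC hyg
  have h1 : ∀ n, g (u (n+1)) ≤ g y + (1/2 : ℝ)^n := by
    intro n
    rw [hu]
    exact hs2 n (u n) y (hSt _ _ _ (hSx n) ⟨hy, hyC, hyg⟩)
  have h2 : l ≤ g y := by
    have h3 : Tendsto (fun n : ℕ => g y + (1/2 : ℝ)^n) atTop (𝓝 (g y + 0)) :=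
      (tendsto_pow_atTop_nhds_zero_of_lt_one (by norm_num) (by norm_num)).const_add _
    have := le_of_tendsto_of_tendsto' ((tendsto_add_atTop_iff_nat 1).2 hl1) h3 h1
    simpa using this
  have h3 : ‖y - xe‖ ≤ 0 := by
    by_contra hh
    push Not at hh
    have := mul_pos hc hh
    linarith
  exact sub_eq_zero.1 (norm_le_zero_iff.1 h3)

lemma minTime_of_mem (M : Set X) (hMsph : M ⊆ Metric.sphere (0 : X) 1) (x y : X)
    (h : y - x ∈ coneOf M) : minTime M x y = ENNReal.ofReal ‖y - x‖ := by
  have key : ∀ r : ℝ, 0 ≤ r → ∀ m ∈ M, y - x = r • m → r = ‖y - x‖ := by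
    intro r hr m hm he
    have : ‖m‖ = 1 := by simpa using hMsph hm
    rw [he, norm_smul, this, Real.norm_of_nonneg hr, mul_one]
  apply le_antisymm
  · obtain ⟨t, ht, m, hm, he⟩ := h
    refine sInf_le ⟨t, ht, by rw [key t ht m hm he], m, hm, ?_⟩
    rw [← he]; abel
  · refine le_sInf ?_
    rintro _ ⟨r, hr, rfl, m, hm, he⟩
    rw [← key r hr m hm (by rw [he]; abel)]

lemma minTime_ne_top (M : Set X) (x y : X) :
    minTime M x y ≠ ⊤ ↔ y - x ∈ coneOf M := by
  constructor
  · intro h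
    by_contra hn
    apply h
    rw [minTime, sInf_eq_top]
    rintro _ ⟨r, hr, rfl, m, hm, he⟩
    exact absurd ⟨r, hr, m, hm, by rw [he]; abel⟩ hn
  · rintro ⟨t, ht, m, hm, he⟩
    refine ne_top_of_le_ne_top ENNReal.ofReal_ne_top (sInf_le ⟨t, ht, rfl, m, hm, ?_⟩)
    rw [← he]; abel

lemma coneOf_smul (M : Set X) (t : ℝ) (ht : 0 ≤ t) (x : X) (hx : x ∈ coneOf M) :
    t • x ∈ coneOf M := by
  obtain ⟨s, hs, m, hm, rfl⟩ := hx
  exact ⟨t * s, mul_nonneg ht hs, m, hm, by rw [mul_smul]⟩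

lemma coneOf_zero (M : Set X) (hM : M.Nonempty) : (0 : X) ∈ coneOf M := by
  obtain ⟨m, hm⟩ := hM
  exact ⟨0, le_rfl, m, hm, by simp⟩

lemma coneOf_add_s6 (M : Set X) (hc : Convex ℝ (coneOf M)) (x : X) (hx : x ∈ coneOf M) (y : X)
    (hy : y ∈ coneOf M) : x + y ∈ coneOf M := by
  have := coneOf_smul M 2 (by norm_num) _
    (hc hx hy (by norm_num : (0 : ℝ) ≤ 1/2) (by norm_num : (0 : ℝ) ≤ 1/2) (by norm_num))
  rwa [← smul_add, smul_smul, show (2 : ℝ) * (1/2) = 1 by norm_num, one_smul] at this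

lemma coneOf_closed (M : Set X) (hM : M.Nonempty) (hMcl : IsClosed M)
    (hMsph : M ⊆ Metric.sphere (0 : X) 1) : IsClosed (coneOf M) := by
  rw [← isSeqClosed_iff_isClosed]
  intro p q hp hq
  by_cases h0 : q = 0
  · rw [h0]; exact coneOf_zero M hM
  have hn : ‖q‖ ≠ 0 := norm_ne_zero_iff.2 h0
  have h1 : Tendsto (fun n => ‖p n‖⁻¹ • p n) atTop (𝓝 (‖q‖⁻¹ • q)) :=
    (hq.norm.inv₀ hn).smul hq
  have h2 : ∀ᶠ n in atTop, ‖p n‖⁻¹ • p n ∈ M := by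
    filter_upwards [hq.norm.eventually_ne hn] with n hne
    obtain ⟨t, ht, m, hm, he⟩ := hp n
    have hm1 : ‖m‖ = 1 := by simpa using hMsph hm
    have : ‖p n‖ = t := by rw [he, norm_smul, hm1, Real.norm_of_nonneg ht, mul_one]
    rw [this] at hne ⊢
    rw [he, smul_smul, inv_mul_cancel₀ hne, one_smul]
    exact hm
  refine ⟨‖q‖, norm_nonneg _, _, hMcl.mem_of_tendsto h1 h2, ?_⟩
  rw [smul_smul, mul_inv_cancel₀ hn, one_smul]

/-- Theorem 3.3, directional Ekeland variational principle. -/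
theorem directional_ekeland [CompleteSpace X]
    (M : Set X) (hMne : M.Nonempty) (hMcl : IsClosed M)
    (hMsph : M ⊆ Metric.sphere (0 : X) 1) (hMcone : Convex ℝ (coneOf M))
    (A : Set X) (hAne : A.Nonempty) (hAcl : IsClosed A)
    (f : X → EReal) (hbot : ∀ x, f x ≠ ⊥) (hproper : ∃ x ∈ A, f x ≠ ⊤)
    (hlsc : LowerSemicontinuousOn f A)
    (xb : X) (hxb : xb ∈ A)
    (hbdd : ∃ b : ℝ, ∀ x ∈ Dset M A xb, (b : EReal) ≤ f x)
    (ε : ℝ) (hε : 0 < ε) (x0 : X) (hx0D : x0 ∈ Dset M A xb)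
    (hx0L : f x0 ≤ sInf (f '' Dset M A xb) + (ε : EReal)) :
    ∃ xe ∈ Dset M A xb,
      minTime M x0 xe ≤ ENNReal.ofReal (Real.sqrt ε) ∧
      f xe + ((ENNReal.ofReal (Real.sqrt ε) * minTime M x0 xe : ℝ≥0∞) : EReal) ≤ f x0 ∧
      ∀ y ∈ Dset M A xb,
        f xe ≤ f y + ((ENNReal.ofReal (Real.sqrt ε) * minTime M xe y : ℝ≥0∞) : EReal) := by
  have hCcl := coneOf_closed M hMne hMcl hMsph
  have hC0 := coneOf_zero M hMne
  have hDm : ∀ y, y ∈ Dset M A xb ↔ y ∈ A ∧ xb - y ∈ coneOf M := by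
    intro y
    simp only [Dset, mem_inter_iff, mem_ofPred_eq, minTime_ne_top]
  have hT0 : ∀ x, minTime M x x = 0 := by
    intro x
    rw [minTime_of_mem M hMsph x x (by simpa using hC0)]; simp
  by_cases htop : f x0 = ⊤
  · have hI : sInf (f '' Dset M A xb) = ⊤ := by
      by_contra hne
      rw [htop, top_le_iff] at hx0L
      exact (EReal.add_lt_top hne (EReal.coe_ne_top ε)).ne hx0L
    refine ⟨x0, hx0D, by simp [hT0], by simp [hT0], fun y hy => ?_⟩
    have : f y = ⊤ := sInf_eq_top.1 hI _ ⟨y, hy, rfl⟩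
    rw [this, EReal.top_add_of_ne_bot (EReal.coe_ennreal_ne_bot _)]
    exact le_top
  set c := Real.sqrt ε with hcdef
  have hc : 0 < c := Real.sqrt_pos.2 hε
  have hcc : c * c = ε := Real.mul_self_sqrt hε.le
  let F : Set X := {z | z ∈ Dset M A xb ∧ f z ≤ f x0}
  let g : X → ℝ := fun x => (f x).toReal
  have hfg : ∀ z ∈ F, f z = (g z : EReal) := fun z hz =>
    (EReal.coe_toReal (ne_top_of_le_ne_top htop hz.2) (hbot z)).symm
  have hDcl : IsClosed (Dset M A xb) := by
    have : Dset M A xb = A ∩ (fun y => xb - y) ⁻¹' coneOf M := by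
      ext y; exact hDm y
    rw [this]
    exact hAcl.inter (hCcl.preimage (by fun_prop))
  have hlD : LowerSemicontinuousOn f (Dset M A xb) := hlsc.mono inter_subset_left
  have hFcl : IsClosed F := by
    rw [← isSeqClosed_iff_isClosed]
    intro p q hp hq
    have hqD : q ∈ Dset M A xb := hDcl.mem_of_tendsto hq (Eventually.of_forall fun n => (hp n).1)
    refine ⟨hqD, ?_⟩
    by_contra hlt
    push Not at hlt
    have h1 : Tendsto p atTop (𝓝[Dset M A xb] q) :=
      tendsto_nhdsWithin_iff.2 ⟨hq, Eventually.of_forall fun n => (hp n).1⟩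
    obtain ⟨n, hn⟩ := (h1.eventually (hlD q hqD _ hlt)).exists
    exact absurd (hp n).2 (not_le.2 hn)
  have hgl : LowerSemicontinuousOn g F := by
    intro x hx a ha
    have h1 : (a : EReal) < f x := by rw [hfg x hx]; exact_mod_cast ha
    have h2 : ∀ᶠ z in 𝓝[F] x, (a : EReal) < f z :=
      (hlD.mono (fun z hz => hz.1 : F ⊆ _)) x hx a h1
    filter_upwards [h2, self_mem_nhdsWithin] with z hz hzF
    rw [hfg z hzF] at hz
    exact_mod_cast hz
  obtain ⟨b, hb⟩ := hbdd
  have hx0F : x0 ∈ F := ⟨hx0D, le_rfl⟩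
  obtain ⟨xe, hxeF, hxeC, hxe2, hxe3⟩ := ek_aux F hFcl g b
    (fun x hx => by have := hb x hx.1; rw [hfg x hx] at this; exact_mod_cast this)
    hgl (coneOf M) hCcl hC0 (coneOf_add_s6 M hMcone) c hc x0 hx0F
  have hmul : ∀ x y, y - x ∈ coneOf M →
      ((ENNReal.ofReal c * minTime M x y : ℝ≥0∞) : EReal) = ((c * ‖y - x‖ : ℝ) : EReal) := by
    intro x y h
    rw [minTime_of_mem M hMsph x y h, ← ENNReal.ofReal_mul hc.le, EReal.coe_ennreal_ofReal,
      max_eq_left (by positivity)]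
  refine ⟨xe, hxeF.1, ?_, ?_, ?_⟩
  · rw [minTime_of_mem M hMsph _ _ hxeC]
    apply ENNReal.ofReal_le_ofReal
    have h1 : f x0 ≤ f xe + (ε : EReal) :=
      hx0L.trans (add_le_add (sInf_le (mem_image_of_mem f hxeF.1)) le_rfl)
    rw [hfg x0 hx0F, hfg xe hxeF] at h1
    have h2 : g x0 ≤ g xe + ε := by exact_mod_cast h1
    have h3 : c * ‖xe - x0‖ ≤ c * c := by linarith
    exact le_of_mul_le_mul_left h3 hc
  · rw [hmul _ _ hxeC, hfg x0 hx0F, hfg xe hxeF]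
    exact_mod_cast hxe2
  · intro y hy
    by_contra hlt
    push Not at hlt
    by_cases hyC : y - xe ∈ coneOf M
    · have hle : f y ≤ f y + ((ENNReal.ofReal c * minTime M xe y : ℝ≥0∞) : EReal) :=
        le_add_of_nonneg_right (EReal.coe_ennreal_nonneg _)
      have hyF : y ∈ F := ⟨hy, (hle.trans hlt.le).trans hxeF.2⟩
      have hl2 := hlt
      rw [hmul _ _ hyC, hfg y hyF, hfg xe hxeF] at hl2
      have h4 : g y + c * ‖y - xe‖ < g xe := by exact_mod_cast hl2
      have h5 := hxe3 y hyF hyC h4.le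
      rw [h5] at h4
      simp at h4
    · have : minTime M xe y = ⊤ := by
        by_contra h
        exact hyC ((minTime_ne_top M xe y).1 h)
      rw [this, ENNReal.mul_top (by simpa using hc), EReal.coe_ennreal_top,
        EReal.add_top_of_ne_bot (hbot y)] at hlt
      exact absurd hlt not_top_lt
end

section
/- Assume A ⊆ X is convex and closed and f is lower semicontinuous and convex. For ε > 0 set G(ε) := {x ∈ A : f(x) ≤ f(y) + ε·T_M(y, x) for all y ∈ D_x}. Then problem (MP) is directionally Tykhonov well-posed with respect to M if and only if there exists x̄ ∈ ⋂_{ε>0} G(ε) such that f is bounded from below on D_x̄ and diam(G'(x̄, ε)) → 0 as ε → 0, where G'(x̄, ε) := {x ∈ D_x̄ : f(x) ≤ f(y) + ε·T_M(x, y) for all y ∈ D_x̄}. -/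
open Filter Topology Set
open scoped ENNReal

variable {X : Type*} [NormedAddCommGroup X] [NormedSpace ℝ X]

theorem aux_minTime_eq (M : Set X) (hM : M ⊆ Metric.sphere (0 : X) 1) {y x : X}
    (h : x - y ∈ coneOf M) : minTime M y x = ENNReal.ofReal ‖x - y‖ := by
  obtain ⟨t, ht, m, hm, e⟩ := h
  have hn : ‖m‖ = 1 := by simpa using hM hm
  have hx : ‖x - y‖ = t := by rw [e, norm_smul, hn, mul_one, Real.norm_of_nonneg ht]
  apply le_antisymm
  · apply sInf_le
    exact ⟨‖x - y‖, norm_nonneg _, rfl, m, hm, by rw [hx, ← e]; abel⟩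
  · apply le_sInf
    rintro _ ⟨r, hr, rfl, m', hm', e'⟩
    have hn' : ‖m'‖ = 1 := by simpa using hM hm'
    have : ‖x - y‖ = r := by
      rw [e', add_sub_cancel_left, norm_smul, hn', mul_one, Real.norm_of_nonneg hr]
    rw [this]

theorem aux_minTime_ne_top (M : Set X) {y x : X} (h : minTime M y x ≠ ⊤) :
    x - y ∈ coneOf M := by
  by_contra hc
  apply h
  unfold minTime
  rw [sInf_eq_top]
  rintro _ ⟨r, hr, rfl, m', hm', e'⟩
  exact absurd ⟨r, hr, m', hm', by rw [e']; abel⟩ hc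

theorem aux_mem_D (M : Set X) (hM : M ⊆ Metric.sphere (0 : X) 1) (A : Set X) (x y : X) :
    y ∈ Dset M A x ↔ y ∈ A ∧ x - y ∈ coneOf M := by
  constructor
  · rintro ⟨h1, h2⟩
    exact ⟨h1, aux_minTime_ne_top M h2⟩
  · rintro ⟨h1, h2⟩
    refine ⟨h1, ?_⟩
    simp [aux_minTime_eq M hM h2]

theorem aux_le_minTime (M : Set X) (hM : M ⊆ Metric.sphere (0 : X) 1) (y x : X) :
    ENNReal.ofReal ‖x - y‖ ≤ minTime M y x := by
  by_cases h : minTime M y x = ⊤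
  · simp [h]
  · exact (aux_minTime_eq M hM (aux_minTime_ne_top M h)).ge

theorem aux_cone_closed (M : Set X) (hne : M.Nonempty) (hcl : IsClosed M)
    (hM : M ⊆ Metric.sphere (0 : X) 1) : IsClosed (coneOf M) := by
  apply IsSeqClosed.isClosed
  intro p q hp hq
  by_cases h0 : q = 0
  · obtain ⟨m, hm⟩ := hne
    exact ⟨0, le_rfl, m, hm, by simp [h0]⟩
  · have hn : ‖q‖ ≠ 0 := by simpa using h0
    have ht : Tendsto (fun n => ‖p n‖⁻¹ • p n) atTop (𝓝 (‖q‖⁻¹ • q)) :=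
      (hq.norm.inv₀ hn).smul hq
    have hev : ∀ᶠ n in atTop, ‖p n‖⁻¹ • p n ∈ M := by
      filter_upwards [hq.norm.eventually_ne hn] with n hnn
      obtain ⟨t, ht, m, hm, e⟩ := hp n
      have hm1 : ‖m‖ = 1 := by simpa using hM hm
      have hx : ‖p n‖ = t := by rw [e, norm_smul, hm1, mul_one, Real.norm_of_nonneg ht]
      rw [hx] at hnn ⊢
      rw [e, smul_smul, inv_mul_cancel₀ hnn, one_smul]
      exact hm
    have hmem := hcl.mem_of_tendsto ht hev
    exact ⟨‖q‖, norm_nonneg _, _, hmem, by rw [smul_smul, mul_inv_cancel₀ hn, one_smul]⟩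

theorem aux_ekeland [CompleteSpace X] (E : Set X) (g : X → ℝ) (ε b : ℝ) (hε : 0 < ε)
    (hb : ∀ x ∈ E, b ≤ g x)
    (hcl : ∀ x ∈ E, IsClosed {y | y ∈ E ∧ g y + ε * dist y x ≤ g x})
    (u : X) (hu : u ∈ E) :
    ∃ z ∈ E, g z + ε * dist z u ≤ g u ∧ ∀ y ∈ E, g z ≤ g y + ε * dist y z := by
  have step : ∀ (n : ℕ) (x : E), ∃ x' : E, g x' + ε * dist (x' : X) x ≤ g x ∧
      ∀ y ∈ E, g y + ε * dist y (x : X) ≤ g x → g x' ≤ g y + ε * (1 / 2) ^ n := by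
    intro n x
    let T := g '' {y | y ∈ E ∧ g y + ε * dist y (x : X) ≤ g x}
    have hTne : T.Nonempty := ⟨g x, x, ⟨x.2, by simp⟩, rfl⟩
    have hTb : BddBelow T := ⟨b, by rintro _ ⟨y, hy, rfl⟩; exact hb y hy.1⟩
    have hpos : (0 : ℝ) < ε * (1 / 2) ^ n := by positivity
    obtain ⟨_, ⟨x', hx', rfl⟩, hlt⟩ := Real.lt_sInf_add_pos hTne hpos
    refine ⟨⟨x', hx'.1⟩, hx'.2, fun y hy hy2 => ?_⟩
    have : sInf T ≤ g y := csInf_le hTb ⟨y, ⟨hy, hy2⟩, rfl⟩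
    simp only
    linarith
  choose nx hnx1 hnx2 using step
  let s : ℕ → E := fun n => Nat.rec ⟨u, hu⟩ (fun n x => nx n x) n
  have hs : ∀ n, s (n + 1) = nx n (s n) := fun n => rfl
  have htrans : ∀ x y z : X, g y + ε * dist y x ≤ g x → g z + ε * dist z y ≤ g y →
      g z + ε * dist z x ≤ g x := by
    intro x y z h1 h2
    have := mul_le_mul_of_nonneg_left (dist_triangle z y x) hε.le
    linarith
  have hmono : ∀ n k : ℕ, g (s (n + k)).1 + ε * dist (s (n + k)).1 (s n).1 ≤ g (s n).1 := by
    intro n k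
    induction k with
    | zero => simp
    | succ k ih =>
      refine htrans _ _ _ ih ?_
      have := hnx1 (n + k) (s (n + k))
      rw [← hs] at this
      exact this
  have hsmall : ∀ n, ∀ y ∈ E, g y + ε * dist y (s (n + 1)).1 ≤ g (s (n + 1)) →
      dist y (s (n + 1)).1 ≤ (1 / 2) ^ n := by
    intro n y hy h
    have h1 := hnx1 n (s n)
    have h2 := hnx2 n (s n) y hy
    rw [← hs] at h1 h2
    have h3 := h2 (htrans _ _ _ h1 h)
    have h4 : ε * dist y (s (n + 1)).1 ≤ ε * (1 / 2) ^ n := by linarith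
    exact le_of_mul_le_mul_left h4 hε
  have hcau : CauchySeq (fun n => (s (n + 1)).1) := by
    apply cauchySeq_of_le_geometric (1 / 2) 1 (by norm_num)
    intro n
    rw [dist_comm, one_mul]
    exact hsmall n _ (s (n + 1 + 1)).2 (hmono (n + 1) 1)
  obtain ⟨z, hz⟩ := cauchySeq_tendsto_of_complete hcau
  have hz' : Tendsto (fun n => (s n).1) atTop (𝓝 z) := (tendsto_add_atTop_iff_nat (f := fun n => (s n).1) 1).1 hz
  have hzS : ∀ n, z ∈ E ∧ g z + ε * dist z (s n).1 ≤ g (s n).1 := by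
    intro n
    have := (hcl (s n).1 (s n).2).mem_of_tendsto hz' (by
      filter_upwards [eventually_ge_atTop n] with m hm
      obtain ⟨k, rfl⟩ := Nat.exists_eq_add_of_le hm
      exact ⟨(s (n + k)).2, hmono n k⟩)
    exact this
  refine ⟨z, (hzS 0).1, (hzS 0).2, fun y hy => ?_⟩
  by_contra hc
  push Not at hc
  have hyz : y = z := by
    have hd : ∀ n, dist y (s (n + 1)).1 ≤ (1 / 2) ^ n := fun n =>
      hsmall n y hy (htrans _ _ _ (hzS (n + 1)).2 hc.le)
    have h1 : Tendsto (fun n : ℕ => (1 / 2 : ℝ) ^ n) atTop (𝓝 0) :=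
      tendsto_pow_atTop_nhds_zero_of_lt_one (by norm_num) (by norm_num)
    have h2 : Tendsto (fun n => dist y (s (n + 1)).1) atTop (𝓝 (dist y z)) :=
      tendsto_const_nhds.dist hz
    have := le_of_tendsto_of_tendsto' h2 h1 hd
    exact dist_le_zero.1 this
  subst hyz
  simp at hc

theorem aux_ekelandE [CompleteSpace X] (D : Set X) (hD : IsClosed D) (f : X → EReal)
    (hbot : ∀ x, f x ≠ ⊥) (hlsc : LowerSemicontinuousOn f D) (ε b : ℝ) (hε : 0 < ε)
    (hb : ∀ x ∈ D, (b : EReal) ≤ f x) (u : X) (hu : u ∈ D) (hut : f u ≠ ⊤) :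
    ∃ z ∈ D, f z + ((ε * dist z u : ℝ) : EReal) ≤ f u ∧
      ∀ y ∈ D, f z ≤ f y + ((ε * dist y z : ℝ) : EReal) := by
  have hco : ∀ x, f x ≤ f u → ((f x).toReal : EReal) = f x := fun x hx =>
    EReal.coe_toReal (ne_top_of_le_ne_top hut hx) (hbot x)
  obtain ⟨z, hz, h1, h2⟩ := aux_ekeland {x | x ∈ D ∧ f x ≤ f u} (fun x => (f x).toReal) ε b hε
    (by
      rintro x ⟨hx, hxu⟩
      have := hb x hx
      rw [← hco x hxu] at this
      exact_mod_cast this)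
    (by
      rintro x ⟨hx, hxu⟩
      apply IsSeqClosed.isClosed
      intro p q hp hq
      have hqD : q ∈ D := hD.mem_of_tendsto hq (Eventually.of_forall fun n => (hp n).1.1)
      have key : f q ≤ (((f x).toReal - ε * dist q x : ℝ) : EReal) := by
        by_contra hc
        push Not at hc
        obtain ⟨c, hc1, hc2⟩ := EReal.lt_iff_exists_real_btwn.1 hc
        have hw : Tendsto p atTop (𝓝[D] q) := tendsto_nhdsWithin_iff.2
          ⟨hq, Eventually.of_forall fun n => (hp n).1.1⟩
        have hev := hw.eventually (hlsc q hqD c hc2)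
        have hle : c ≤ (f x).toReal - ε * dist q x := by
          have ht : Tendsto (fun n => (f x).toReal - ε * dist (p n) x) atTop
              (𝓝 ((f x).toReal - ε * dist q x)) :=
            tendsto_const_nhds.sub ((hq.dist tendsto_const_nhds).const_mul ε)
          apply ge_of_tendsto ht
          filter_upwards [hev] with n hn
          have h3 := (hp n).2
          have h4 := hco (p n) (hp n).1.2
          rw [← h4] at hn
          have h5 : c < (f (p n)).toReal := by exact_mod_cast hn
          linarith
        have : c > (f x).toReal - ε * dist q x := by exact_mod_cast hc1
        linarith
      have hqx : f q ≤ f x := by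
        rw [← hco x hxu]
        refine key.trans ?_
        have : 0 ≤ ε * dist q x := by positivity
        exact_mod_cast (by linarith : (f x).toReal - ε * dist q x ≤ (f x).toReal)
      refine ⟨⟨hqD, hqx.trans hxu⟩, ?_⟩
      rw [← hco q (hqx.trans hxu)] at key
      have : (f q).toReal ≤ (f x).toReal - ε * dist q x := by exact_mod_cast key
      linarith)
    u ⟨hu, le_rfl⟩
  refine ⟨z, hz.1, ?_, fun y hy => ?_⟩
  · rw [← hco z hz.2, ← hco u le_rfl]
    exact_mod_cast h1
  · by_cases hyu : f y ≤ f u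
    · have := h2 y ⟨hy, hyu⟩
      rw [← hco z hz.2, ← hco y hyu]
      exact_mod_cast this
    · push Not at hyu
      have h0 : (0 : EReal) ≤ ((ε * dist y z : ℝ) : EReal) := by
        exact_mod_cast (by positivity : 0 ≤ ε * dist y z)
      calc f z ≤ f y := hz.2.trans hyu.le
        _ = f y + 0 := by simp
        _ ≤ _ := by gcongr

theorem aux_coe_mul (ε d : ℝ) (hε : 0 ≤ ε) (hd : 0 ≤ d) :
    ((ENNReal.ofReal ε * ENNReal.ofReal d : ℝ≥0∞) : EReal) = ((ε * d : ℝ) : EReal) := by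
  rw [← ENNReal.ofReal_mul hε, EReal.coe_ennreal_ofReal, max_eq_left (by positivity)]

/-- Theorem 3.4: with `A` convex closed and `f` lsc convex, (MP) is
directionally Tykhonov well-posed w.r.t. `M` iff there is `x̄ ∈ ⋂_{ε>0} G(ε)` with `f`
bounded below on `D_x̄` and `diam G'(x̄,ε) → 0` as `ε → 0⁺`. -/
theorem dirTykhonovWP_iff_G [CompleteSpace X]
    (M : Set X) (hMne : M.Nonempty) (hMcl : IsClosed M)
    (hMsph : M ⊆ Metric.sphere (0 : X) 1) (hMcone : Convex ℝ (coneOf M))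
    (A : Set X) (hAne : A.Nonempty) (hAcl : IsClosed A) (hAconv : Convex ℝ A)
    (f : X → EReal) (hbot : ∀ x, f x ≠ ⊥) (hproper : ∃ x ∈ A, f x ≠ ⊤)
    (hlsc : LowerSemicontinuousOn f A)
    (hconv : ∀ x ∈ A, ∀ y ∈ A, ∀ a b : ℝ, 0 ≤ a → 0 ≤ b → a + b = 1 →
      f (a • x + b • y) ≤ (a : EReal) * f x + (b : EReal) * f y) :
    DirTykhonovWP M A f ↔
      ∃ xb,
        (∀ ε : ℝ, 0 < ε → xb ∈ {x ∈ A | ∀ y ∈ Dset M A x,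
            f x ≤ f y + ((ENNReal.ofReal ε * minTime M y x : ℝ≥0∞) : EReal)}) ∧
        (∃ b : ℝ, ∀ x ∈ Dset M A xb, (b : EReal) ≤ f x) ∧
        Tendsto (fun ε : ℝ =>
            EMetric.diam {x ∈ Dset M A xb | ∀ y ∈ Dset M A xb,
              f x ≤ f y + ((ENNReal.ofReal ε * minTime M x y : ℝ≥0∞) : EReal)})
          (𝓝[>] 0) (𝓝 0) := by
  have hsub : ∀ x, x ∈ A → x ∈ Dset M A x := by
    intro x hx
    rw [aux_mem_D M hMsph]
    obtain ⟨m, hm⟩ := hMne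
    exact ⟨hx, 0, le_rfl, m, hm, by simp⟩
  have hT : ∀ x y, y ∈ Dset M A x → minTime M y x = ENNReal.ofReal (dist y x) := by
    intro x y hy
    rw [aux_minTime_eq M hMsph ((aux_mem_D M hMsph A x y).1 hy).2, dist_comm, dist_eq_norm]
  constructor
  · rintro ⟨xb, hxA, hmin, huniq, hseq⟩
    refine ⟨xb, ?_, ?_, ?_⟩
    · intro ε hε
      refine ⟨hxA, fun y hy => ?_⟩
      calc f xb ≤ f y + 0 := by simpa using hmin y hy
        _ ≤ _ := by gcongr; exact EReal.coe_ennreal_nonneg _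
    · by_cases ht : f xb = ⊤
      · exact ⟨0, fun x hx => by have := hmin x hx; rw [ht, top_le_iff] at this; simp [this]⟩
      · refine ⟨(f xb).toReal, fun x hx => ?_⟩
        rw [EReal.coe_toReal ht (hbot _)]
        exact hmin x hx
    · have main : ∀ η : ℝ, 0 < η → ∀ᶠ ε : ℝ in 𝓝[>] 0, ∀ x ∈ Dset M A xb,
          (∀ y ∈ Dset M A xb,
            f x ≤ f y + ((ENNReal.ofReal ε * minTime M x y : ℝ≥0∞) : EReal)) →
          dist x xb ≤ η := by
        intro η hη
        by_cases ht : f xb = ⊤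
        · refine Eventually.of_forall fun ε x hx _ => ?_
          have h1 := hmin x hx
          rw [ht, top_le_iff] at h1
          rw [huniq x hx (by rw [h1, ht]), dist_self]
          exact hη.le
        by_contra hc
        have hfr := not_eventually.1 hc
        have hk : ∀ k : ℕ, ∃ v ∈ Dset M A xb, dist v xb = η ∧
            f v ≤ (((f xb).toReal + (1 / ((k : ℝ) + 1)) * η : ℝ) : EReal) := by
          intro k
          have hpos : (0 : ℝ) < 1 / ((k : ℝ) + 1) := by positivity
          have hev : ∀ᶠ ε : ℝ in 𝓝[>] 0, ε ∈ Ioo 0 (1 / ((k : ℝ) + 1)) :=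
            Ioo_mem_nhdsGT hpos
          obtain ⟨ε, hε, hεI⟩ := (hfr.and_eventually hev).exists
          push Not at hε
          obtain ⟨x, hx, hxG, hxη⟩ := hε
          have hd0 : 0 < dist x xb := hη.trans hxη
          have hxx := (aux_mem_D M hMsph A xb x).1 hx
          have h1 := hxG xb (hsub xb hxA)
          rw [hT xb x hx, aux_coe_mul _ _ hεI.1.le dist_nonneg,
            ← EReal.coe_toReal ht (hbot _), ← EReal.coe_add] at h1
          have hxt : f x ≠ ⊤ := ne_top_of_le_ne_top (EReal.coe_ne_top _) h1
          rw [← EReal.coe_toReal hxt (hbot _)] at h1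
          have h1' : (f x).toReal ≤ (f xb).toReal + ε * dist x xb := by exact_mod_cast h1
          set l := η / dist x xb with hl
          have hl0 : 0 ≤ l := by positivity
          have hl1 : l ≤ 1 := by rw [hl, div_le_one hd0]; exact hxη.le
          have hld : l * dist x xb = η := by rw [hl]; field_simp
          have hdiff : xb - (l • x + (1 - l) • xb) = l • (xb - x) := by module
          refine ⟨l • x + (1 - l) • xb, ?_, ?_, ?_⟩
          · rw [aux_mem_D M hMsph]
            refine ⟨hAconv hxx.1 hxA hl0 (by linarith) (by ring), ?_⟩
            obtain ⟨t, ht0, m, hm, e⟩ := hxx.2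
            exact ⟨l * t, by positivity, m, hm, by rw [hdiff, e, smul_smul]⟩
          · rw [dist_comm, dist_eq_norm, hdiff, norm_smul, Real.norm_of_nonneg hl0,
              ← dist_eq_norm, dist_comm xb x, hld]
          · refine (hconv x hxx.1 xb hxA l (1 - l) hl0 (by linarith) (by ring)).trans ?_
            rw [← EReal.coe_toReal hxt (hbot _), ← EReal.coe_toReal ht (hbot _)]
            simp only [EReal.toReal_coe]
            rw [← EReal.coe_mul, ← EReal.coe_mul, ← EReal.coe_add, EReal.coe_le_coe_iff]
            have h2 := mul_le_mul_of_nonneg_left h1' hl0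
            have h3 : l * (ε * dist x xb) = ε * η := by rw [← hld]; ring
            have h4 : ε * η ≤ 1 / ((k : ℝ) + 1) * η :=
              mul_le_mul_of_nonneg_right hεI.2.le hη.le
            nlinarith
        choose v hvD hvd hvf using hk
        have hlim : Tendsto (fun k => f (v k)) atTop (𝓝 (f xb)) := by
          have hup : Tendsto (fun k : ℕ =>
              (((f xb).toReal + (1 / ((k : ℝ) + 1)) * η : ℝ) : EReal)) atTop (𝓝 (f xb)) := by
            have h0 : Tendsto (fun k : ℕ => (f xb).toReal + (1 / ((k : ℝ) + 1)) * η) atTop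
                (𝓝 ((f xb).toReal + 0 * η)) :=
              tendsto_const_nhds.add (tendsto_one_div_add_atTop_nhds_zero_nat.mul_const η)
            have h1 := (continuous_coe_real_ereal.tendsto _).comp h0
            rw [zero_mul, add_zero, EReal.coe_toReal ht (hbot _)] at h1
            exact h1
          exact tendsto_of_tendsto_of_tendsto_of_le_of_le tendsto_const_nhds hup
            (fun k => hmin _ (hvD k)) hvf
        have h1 := hseq v hvD hlim
        have h2 : (fun k => minTime M (v k) xb) = fun _ => ENNReal.ofReal η := by
          funext k
          rw [hT xb _ (hvD k), hvd]
        rw [h2] at h1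
        have h3 := tendsto_nhds_unique h1 tendsto_const_nhds
        have h4 : 0 < ENNReal.ofReal η := ENNReal.ofReal_pos.2 hη
        rw [← h3] at h4
        exact lt_irrefl _ h4
      rw [ENNReal.tendsto_nhds_zero]
      intro δ hδ
      obtain ⟨r, hr0, hrδ⟩ := ENNReal.lt_iff_exists_real_btwn.1 hδ
      have hr : 0 < r := by simpa using hrδ.1
      filter_upwards [main (r / 2) (by positivity)] with ε hε
      refine le_trans (Metric.ediam_le ?_) hrδ.2.le
      rintro x ⟨hx, hx2⟩ y ⟨hy, hy2⟩
      rw [edist_dist]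
      apply ENNReal.ofReal_le_ofReal
      have := dist_triangle_right x y xb
      have := hε x hx hx2
      have := hε y hy hy2
      linarith
  · rintro ⟨xb, hG, ⟨b, hb⟩, hdiam⟩
    have hxA : xb ∈ A := (hG 1 one_pos).1
    have hmin : ∀ x ∈ Dset M A xb, f xb ≤ f x := by
      intro y hy
      by_cases hyt : f y = ⊤
      · simp [hyt]
      apply le_of_forall_gt
      intro c hc
      obtain ⟨r, hr1, hr2⟩ := EReal.lt_iff_exists_real_btwn.1 hc
      refine lt_of_le_of_lt ?_ hr2
      rw [← EReal.coe_toReal hyt (hbot _)] at hr1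
      have hr3 : (f y).toReal < r := by exact_mod_cast hr1
      have hd : 0 < dist y xb + 1 := by positivity
      set ε := (r - (f y).toReal) / (dist y xb + 1) with hεd
      have hε : 0 < ε := div_pos (by linarith) hd
      have h1 := (hG ε hε).2 y hy
      rw [hT xb y hy, aux_coe_mul _ _ hε.le dist_nonneg, ← EReal.coe_toReal hyt (hbot _),
        ← EReal.coe_add] at h1
      refine h1.trans ?_
      rw [EReal.coe_le_coe_iff]
      have : ε * (dist y xb + 1) = r - (f y).toReal := by rw [hεd]; field_simp
      nlinarith
    have hGmin : ∀ x ∈ Dset M A xb, f x ≤ f xb → ∀ ε : ℝ,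
        x ∈ {x ∈ Dset M A xb | ∀ y ∈ Dset M A xb,
              f x ≤ f y + ((ENNReal.ofReal ε * minTime M x y : ℝ≥0∞) : EReal)} := by
      intro x hx hle ε
      refine ⟨hx, fun y hy => ?_⟩
      calc f x ≤ f y + 0 := by simpa using hle.trans (hmin y hy)
        _ ≤ _ := by gcongr; exact EReal.coe_ennreal_nonneg _
    have huniq : ∀ x ∈ Dset M A xb, f x = f xb → x = xb := by
      intro x hx hfx
      have h1 : ∀ ε : ℝ, edist x xb ≤ _ := fun ε =>
        Metric.edist_le_ediam_of_mem (hGmin x hx hfx.le ε) (hGmin xb (hsub xb hxA) le_rfl ε)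
      have := ge_of_tendsto' hdiam h1
      exact edist_le_zero.1 this
    refine ⟨xb, hxA, hmin, huniq, ?_⟩
    intro u hu hlim
    by_cases ht : f xb = ⊤
    · have : ∀ k, u k = xb := fun k => huniq _ (hu k) (by
        have h1 := hmin _ (hu k)
        rw [ht, top_le_iff] at h1
        rw [h1, ht])
      have h2 : (fun k => minTime M (u k) xb) = fun _ => 0 := by
        funext k
        rw [hT xb _ (hu k), this k]
        simp
      rw [h2]
      exact tendsto_const_nhds
    have hDcl : IsClosed (Dset M A xb) := by
      have : Dset M A xb = A ∩ (fun y => xb - y) ⁻¹' coneOf M := by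
        ext y
        exact aux_mem_D M hMsph A xb y
      rw [this]
      exact hAcl.inter ((aux_cone_closed M hMne hMcl hMsph).preimage (by fun_prop))
    have hDlsc : LowerSemicontinuousOn f (Dset M A xb) := hlsc.mono fun y hy => hy.1
    rw [ENNReal.tendsto_nhds_zero]
    intro δ hδ
    obtain ⟨r, hr0, hrδ⟩ := ENNReal.lt_iff_exists_real_btwn.1 hδ
    have hr : 0 < r := by simpa using hrδ.1
    have hev1 := (ENNReal.tendsto_nhds_zero.1 hdiam) (ENNReal.ofReal (r / 2))
      (ENNReal.ofReal_pos.2 (by positivity))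
    obtain ⟨ε, hdε, hε⟩ := (hev1.and self_mem_nhdsWithin).exists
    have hε : 0 < ε := hε
    have hlt : f xb < (((f xb).toReal + ε * (r / 2) : ℝ) : EReal) := by
      have h0 : 0 < ε * (r / 2) := by positivity
      conv_lhs => rw [← EReal.coe_toReal ht (hbot _)]
      rw [EReal.coe_lt_coe_iff]
      linarith
    filter_upwards [hlim.eventually (gt_mem_nhds hlt)] with k hk
    refine le_trans ?_ hrδ.2.le
    have hut : f (u k) ≠ ⊤ := ne_top_of_lt hk
    obtain ⟨z, hz, hz1, hz2⟩ := aux_ekelandE _ hDcl f hbot hDlsc ε b hε hb (u k) (hu k) hut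
    rw [hT xb _ (hu k)]
    apply ENNReal.ofReal_le_ofReal
    have hzG : z ∈ {x ∈ Dset M A xb | ∀ y ∈ Dset M A xb,
              f x ≤ f y + ((ENNReal.ofReal ε * minTime M x y : ℝ≥0∞) : EReal)} := by
      refine ⟨hz, fun y hy => (hz2 y hy).trans ?_⟩
      gcongr
      rw [← aux_coe_mul _ _ hε.le dist_nonneg, dist_eq_norm]
      rw [EReal.coe_ennreal_le_coe_ennreal_iff]
      gcongr
      exact aux_le_minTime M hMsph z y
    have h1 := (Metric.edist_le_ediam_of_mem hzG
      (hGmin xb (hsub xb hxA) le_rfl ε)).trans hdε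
    rw [edist_dist, ENNReal.ofReal_le_ofReal_iff (by positivity)] at h1
    have h2 : dist z (u k) ≤ r / 2 := by
      have h3 : f xb + ((ε * dist z (u k) : ℝ) : EReal) ≤
          (((f xb).toReal + ε * (r / 2) : ℝ) : EReal) := by
        refine le_trans ?_ (hz1.trans hk.le)
        gcongr
        exact hmin z hz
      have h4 : (((f xb).toReal + ε * dist z (u k) : ℝ) : EReal) ≤
          (((f xb).toReal + ε * (r / 2) : ℝ) : EReal) := by
        rw [EReal.coe_add, EReal.coe_toReal ht (hbot _)]
        exact h3
      rw [EReal.coe_le_coe_iff] at h4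
      exact le_of_mul_le_mul_left (by linarith) hε
    have h3 := dist_triangle (u k) z xb
    rw [dist_comm (u k) z] at h3
    linarith
end

section
/- Define c₀(t) := inf{f(x) − f(x̄) : x ∈ D_x̄, T_M(x, x̄) = t} for t ≥ 0 (with inf ∅ = +∞), L(x̄, ε) := {y ∈ D_x̄ : f(y) ≤ inf_{x ∈ D_x̄} f(x) + ε}, and r(ε) := (1/2)·diam(L(x̄, ε)). For every t > 0 with 0 < c₀(t) < ∞, the inequalities t/2 ≤ r(c₀(t)) ≤ t hold. -/
open Filter Topology Set
open scoped ENNReal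

variable {X : Type*} [NormedAddCommGroup X] [NormedSpace ℝ X]

/-- `c₀(t) = inf {f(x) − f(x̄) | x ∈ D_x̄, T_M(x,x̄) = t}`, with `inf ∅ = +∞`. -/
noncomputable def cZero (M A : Set X) (f : X → EReal) (xb : X) (t : ℝ) : EReal :=
  sInf {v : EReal | ∃ x ∈ Dset M A xb, minTime M x xb = ENNReal.ofReal t ∧ v = f x - f xb}

/-- The level set `L(x̄,ε) = {y ∈ D_x̄ | f(y) ≤ inf_{D_x̄} f + ε}`. -/
def Lset (M A : Set X) (f : X → EReal) (xb : X) (ε : ℝ) : Set X :=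
  {y ∈ Dset M A xb | f y ≤ sInf (f '' Dset M A xb) + (ε : EReal)}

theorem minTime_eq_aux (M : Set X) (hMsph : M ⊆ Metric.sphere (0 : X) 1) (x y : X) (r : ℝ)
    (hr : 0 ≤ r) (m : X) (hm : m ∈ M) (h : x = y + r • m) :
    minTime M y x = ENNReal.ofReal ‖x - y‖ := by
  have key : ∀ r : ℝ, 0 ≤ r → ∀ m ∈ M, x = y + r • m → r = ‖x - y‖ := by
    intro r hr m hm h
    have h1 : ‖m‖ = 1 := by simpa using hMsph hm
    rw [h, add_sub_cancel_left, norm_smul, h1, mul_one, Real.norm_of_nonneg hr]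
  apply le_antisymm
  · exact sInf_le ⟨r, hr, by rw [← key r hr m hm h], m, hm, h⟩
  · apply le_sInf
    rintro _ ⟨r', hr', rfl, m', hm', h'⟩
    rw [← key r' hr' m' hm' h']

theorem minTime_ex_aux (M : Set X) (x y : X) (h : minTime M y x ≠ ⊤) :
    ∃ r : ℝ, 0 ≤ r ∧ ∃ m ∈ M, x = y + r • m := by
  have h2 : minTime M y x < ⊤ := lt_top_iff_ne_top.2 h
  obtain ⟨_, ⟨r, hr, -, hm⟩, -⟩ := sInf_lt_iff.1 h2
  exact ⟨r, hr, hm⟩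

theorem minTime_seg_aux (M A : Set X) (hMsph : M ⊆ Metric.sphere (0 : X) 1)
    (hAconv : Convex ℝ A) (xb : X) (hxb : xb ∈ A) (x : X) (hx : x ∈ Dset M A xb)
    (s : ℝ) (hs0 : 0 ≤ s) (hs1 : s ≤ 1) :
    s • x + (1 - s) • xb ∈ Dset M A xb ∧
    minTime M (s • x + (1 - s) • xb) xb = ENNReal.ofReal (s * ‖xb - x‖) := by
  obtain ⟨r, hr, m, hm, h⟩ := minTime_ex_aux M xb x hx.2
  have e1 : xb = s • x + (1 - s) • xb + (s * r) • m := by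
    have : r • m = xb - x := by rw [eq_sub_iff_add_eq, add_comm]; exact h.symm
    rw [mul_smul, this]; module
  have e2 := minTime_eq_aux M hMsph xb _ (s * r) (mul_nonneg hs0 hr) m hm e1
  have e3 : xb - (s • x + (1 - s) • xb) = s • (xb - x) := by module
  rw [e3, norm_smul, Real.norm_of_nonneg hs0] at e2
  refine ⟨⟨hAconv hx.1 hxb hs0 (by linarith) (by ring), ?_⟩, e2⟩
  simp [e2]

/-- Theorem 4.1: for every `t > 0` with `0 < c₀(t) < ∞`,
`t/2 ≤ r(c₀(t)) ≤ t`, where `r(ε) = diam(L(x̄,ε))/2`. -/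
theorem cZero_radius_bounds [CompleteSpace X]
    (M : Set X) (hMne : M.Nonempty) (hMcl : IsClosed M)
    (hMsph : M ⊆ Metric.sphere (0 : X) 1) (hMcone : Convex ℝ (coneOf M))
    (A : Set X) (hAne : A.Nonempty) (hAcl : IsClosed A) (hAconv : Convex ℝ A)
    (f : X → EReal) (hbot : ∀ x, f x ≠ ⊥)
    (xb : X) (hxb : xb ∈ A) (hfxb : f xb ≠ ⊤)
    (hmin : ∀ x ∈ Dset M A xb, f xb ≤ f x)
    (hsub : ∀ x ∈ Dset M A xb, ∀ s : ℝ, 0 ≤ s → s ≤ 1 →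
      f (s • x + (1 - s) • xb) ≤ (s : EReal) * f x + ((1 - s : ℝ) : EReal) * f xb)
    (t : ℝ) (ht : 0 < t)
    (hcpos : 0 < cZero M A f xb t) (hcfin : cZero M A f xb t ≠ ⊤) :
    ENNReal.ofReal t / 2
        ≤ EMetric.diam (Lset M A f xb ((cZero M A f xb t).toReal)) / 2 ∧
      EMetric.diam (Lset M A f xb ((cZero M A f xb t).toReal)) / 2
        ≤ ENNReal.ofReal t := by
  obtain ⟨a, ha⟩ : ∃ a : ℝ, f xb = a :=
    ⟨(f xb).toReal, (EReal.coe_toReal hfxb (hbot xb)).symm⟩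
  obtain ⟨c, hc⟩ : ∃ c : ℝ, cZero M A f xb t = c :=
    ⟨_, (EReal.coe_toReal hcfin (ne_bot_of_gt hcpos)).symm⟩
  have hc0 : 0 < c := by rw [hc] at hcpos; exact_mod_cast hcpos
  have hT : ∀ x ∈ Dset M A xb, minTime M x xb = ENNReal.ofReal ‖xb - x‖ := by
    intro x hx
    obtain ⟨r, hr, m, hm, h⟩ := minTime_ex_aux M xb x hx.2
    exact minTime_eq_aux M hMsph xb x r hr m hm h
  have hxD : xb ∈ Dset M A xb := by
    obtain ⟨m, hm⟩ := hMne
    refine ⟨hxb, ?_⟩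
    have := minTime_eq_aux M hMsph xb xb 0 le_rfl m hm (by simp)
    simp [this]
  have hinf : sInf (f '' Dset M A xb) = (a : EReal) := by
    rw [← ha]
    apply le_antisymm
    · exact sInf_le ⟨xb, hxD, rfl⟩
    · apply le_sInf
      rintro _ ⟨x, hx, rfl⟩
      exact hmin x hx
  have hL : ∀ y, y ∈ Lset M A f xb c ↔ y ∈ Dset M A xb ∧ f y ≤ ((a + c : ℝ) : EReal) := by
    intro y
    simp only [Lset, hinf, EReal.coe_add, Set.mem_setOf_eq]
  have hsub' : ∀ x ∈ Dset M A xb, ∀ b : ℝ, f x ≤ ((a + b : ℝ) : EReal) → ∀ s : ℝ, 0 ≤ s → s ≤ 1 →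
      f (s • x + (1 - s) • xb) ≤ ((a + s * b : ℝ) : EReal) := by
    intro x hx b hb s hs0 hs1
    obtain ⟨v, hv⟩ : ∃ v : ℝ, f x = v :=
      ⟨_, (EReal.coe_toReal (ne_top_of_le_ne_top (EReal.coe_ne_top _) hb) (hbot x)).symm⟩
    have h := hsub x hx s hs0 hs1
    rw [hv, ha, ← EReal.coe_mul, ← EReal.coe_mul, ← EReal.coe_add] at h
    refine h.trans ?_
    rw [hv] at hb
    have hb' : v ≤ a + b := by exact_mod_cast hb
    apply EReal.coe_le_coe_iff.2
    nlinarith [mul_le_mul_of_nonneg_left hb' hs0]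
  rw [hc, EReal.toReal_coe]
  constructor
  · gcongr
    by_contra hlt
    rw [not_le] at hlt
    obtain ⟨u, hu1, hu2⟩ := exists_between hlt
    lift u to NNReal using hu2.ne_top
    have hut : (u : ℝ) < t := by
      rw [← ENNReal.ofReal_coe_nnreal, ENNReal.ofReal_lt_ofReal_iff ht] at hu2
      exact hu2
    have hu0 : 0 < (u : ℝ) := by
      have : (0 : ℝ≥0∞) < u := pos_of_gt hu1
      exact_mod_cast this
    have hs0 : 0 < (u : ℝ) / t := div_pos hu0 ht
    have hs1 : (u : ℝ) / t < 1 := (div_lt_one ht).2 hut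
    set s : ℝ := (u : ℝ) / t with hs
    have hcs : c < c / s := by rw [lt_div_iff₀ hs0]; nlinarith
    have h1 : cZero M A f xb t < ((c / s : ℝ) : EReal) := by
      rw [hc]; exact_mod_cast hcs
    obtain ⟨_, ⟨x, hx, hxt, rfl⟩, hlt2⟩ := sInf_lt_iff.1 h1
    have hfx : f x ≤ ((a + c / s : ℝ) : EReal) := by
      rw [ha] at hlt2
      have := EReal.sub_le_iff_le_add (Or.inl (EReal.coe_ne_bot a)) (Or.inl (EReal.coe_ne_top a)) |>.1 hlt2.le
      rw [add_comm, EReal.coe_add]; rwa [add_comm, add_comm (a : EReal)] 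
    have h2 := hsub' x hx _ hfx s hs0.le hs1.le
    rw [mul_div_cancel₀ _ hs0.ne'] at h2
    have h3 := minTime_seg_aux M A hMsph hAconv xb hxb x hx s hs0.le hs1.le
    have hz := (hL _).2 ⟨h3.1, h2⟩
    have hxL := (hL xb).2 ⟨hxD, by rw [ha]; exact_mod_cast (by linarith : a ≤ a + c)⟩
    have h4 := EMetric.edist_le_diam_of_mem hxL hz
    rw [edist_dist, dist_eq_norm, ← hT _ h3.1, h3.2] at h4
    have hn : ‖xb - x‖ = t := by
      rw [hT x hx, ENNReal.ofReal_eq_ofReal_iff (norm_nonneg _) ht.le] at hxt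
      exact hxt
    rw [hn, hs, div_mul_cancel₀ _ ht.ne', ENNReal.ofReal_coe_nnreal] at h4
    exact absurd h4 (not_le.2 hu1)
  · have hball : ∀ y ∈ Lset M A f xb c, ‖xb - y‖ ≤ t := by
      intro y hy
      by_contra hlt
      rw [not_le] at hlt
      obtain ⟨hyD, hyf⟩ := (hL y).1 hy
      have hn0 : 0 < ‖xb - y‖ := ht.trans hlt
      have hs0 : 0 < t / ‖xb - y‖ := div_pos ht hn0
      have hs1 : t / ‖xb - y‖ < 1 := (div_lt_one hn0).2 hlt
      have h2 := hsub' y hyD _ hyf _ hs0.le hs1.le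
      have h3 := minTime_seg_aux M A hMsph hAconv xb hxb y hyD _ hs0.le hs1.le
      rw [div_mul_cancel₀ _ hn0.ne'] at h3
      have h5 : cZero M A f xb t ≤ _ := sInf_le ⟨_, h3.1, h3.2, rfl⟩
      rw [hc, ha] at h5
      have h6 := h5.trans (EReal.sub_le_sub h2 (le_refl (a : EReal)))
      rw [← EReal.coe_sub, EReal.coe_le_coe_iff] at h6
      nlinarith
    have hd : EMetric.diam (Lset M A f xb c) ≤ ENNReal.ofReal (t + t) := by
      apply EMetric.diam_le
      intro x hx y hy
      rw [edist_dist]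
      apply ENNReal.ofReal_le_ofReal
      refine (dist_triangle x xb y).trans (add_le_add ?_ ?_)
      · rw [dist_comm, dist_eq_norm]; exact hball x hx
      · rw [dist_eq_norm]; exact hball y hy
    apply ENNReal.div_le_of_le_mul
    refine hd.trans ?_
    rw [ENNReal.ofReal_add ht.le ht.le, mul_two]
end

section
/- (Minty-type equality.) Let V be monotone and hemicontinuous and take g ≡ 0. For ε > 0 and x̄ ∈ A define S(ε) := {x ∈ A : ⟨V(y), x − y⟩ ≤ ε·T_M(y, x) for all y ∈ D_x} and S'(x̄, ε) := {x ∈ D_x̄ : ⟨V(y), x − y⟩ ≤ ε·T_M(x, y) for all y ∈ D_x̄}. Then S(ε) = R(ε) and S'(x̄, ε) = R'(x̄, ε), where R(ε) := {x ∈ A : ⟨V(x), x − y⟩ ≤ ε·T_M(y, x) for all y ∈ D_x} and R'(x̄, ε) := {x ∈ D_x̄ : ⟨V(x), x − y⟩ ≤ ε·T_M(x, y) for all y ∈ D_x̄}. -/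
open Filter Topology Set
open scoped ENNReal

variable {X : Type*} [NormedAddCommGroup X] [NormedSpace ℝ X]

theorem mt_of_mem {M : Set X} (hM : M ⊆ Metric.sphere (0 : X) 1) {y x : X}
    (h : x - y ∈ coneOf M) : minTime M y x = ENNReal.ofReal ‖x - y‖ := by
  have key : ∀ r : ℝ, 0 ≤ r → ∀ m ∈ M, x = y + r • m → r = ‖x - y‖ := by
    intro r hr m hm e
    have h1 : ‖m‖ = 1 := by simpa using hM hm
    rw [e, add_sub_cancel_left, norm_smul, h1, Real.norm_of_nonneg hr, mul_one]
  apply le_antisymm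
  · obtain ⟨t, ht, m, hm, e⟩ := h
    have e' : x = y + t • m := by rw [← e]; abel
    refine sInf_le ⟨t, ht, ?_, m, hm, e'⟩
    rw [← key t ht m hm e']
  · refine le_sInf ?_
    rintro _ ⟨r, hr, rfl, m, hm, e⟩
    rw [← key r hr m hm e]

theorem mt_ne_top {M : Set X} (hM : M ⊆ Metric.sphere (0 : X) 1) {y x : X} :
    minTime M y x ≠ ⊤ ↔ x - y ∈ coneOf M := by
  constructor
  · intro h
    by_contra hn
    apply h
    unfold minTime
    rw [sInf_eq_top]
    rintro _ ⟨r, hr, rfl, m, hm, e⟩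
    exact absurd ⟨r, hr, m, hm, by rw [e]; abel⟩ hn
  · intro h
    rw [mt_of_mem hM h]
    exact ENNReal.ofReal_ne_top

theorem coe_iff {ε a r : ℝ} (hε : 0 < ε) (hr : 0 ≤ r) :
    ((a : ℝ) : EReal) ≤ ((ENNReal.ofReal ε * ENNReal.ofReal r : ℝ≥0∞) : EReal) ↔ a ≤ ε * r := by
  rw [← ENNReal.ofReal_mul hε.le, EReal.coe_ennreal_ofReal, max_eq_left (mul_nonneg hε.le hr),
    EReal.coe_le_coe_iff]

theorem cone_smul {M : Set X} {p : X} {l : ℝ} (hl : 0 ≤ l) (h : p ∈ coneOf M) :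
    l • p ∈ coneOf M := by
  obtain ⟨t, ht, m, hm, e⟩ := h
  exact ⟨l * t, mul_nonneg hl ht, m, hm, by rw [e, smul_smul]⟩

theorem limit_lem (V : X → (X →L[ℝ] ℝ))
    (hhemi : ∀ x y : X, ∀ l : ℕ → ℝ, (∀ k, 0 < l k) → Tendsto l atTop (𝓝 0) →
      ∀ d : X, Tendsto (fun k => V (x + l k • y) d) atTop (𝓝 (V x d)))
    (x y : X) (c : ℝ)
    (h : ∀ l : ℝ, 0 < l → l ≤ 1 →
      V (x + l • (y - x)) (x - (x + l • (y - x))) ≤ l * c) : V x (x - y) ≤ c := by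
  have hpos : ∀ k : ℕ, (0 : ℝ) < 1 / ((k : ℝ) + 1) := fun k => Nat.one_div_pos_of_nat
  refine le_of_tendsto' (hhemi x (y - x) (fun k : ℕ => 1 / ((k : ℝ) + 1)) hpos
    tendsto_one_div_add_atTop_nhds_zero_nat (x - y)) ?_
  intro k
  have h1 := h _ (hpos k) (by
    rw [div_le_one (by positivity)]
    have : (0 : ℝ) ≤ k := Nat.cast_nonneg k
    linarith)
  have e : ∀ l : ℝ, x - (x + l • (y - x)) = l • (x - y) := by
    intro l; module
  rw [e, map_smul, smul_eq_mul] at h1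
  exact le_of_mul_le_mul_left h1 (hpos k)

/-- Proposition 5.1, Minty-type equalities: for a monotone and
hemicontinuous operator `V` (and `g ≡ 0`), for every `ε > 0` and `x̄ ∈ A`,
`S(ε) = R(ε)` and `S'(x̄,ε) = R'(x̄,ε)`. -/
theorem minty_sets_eq [CompleteSpace X]
    (hrefl : Function.Surjective ⇑(NormedSpace.inclusionInDoubleDual ℝ X))
    (M : Set X) (hMne : M.Nonempty) (hMcl : IsClosed M)
    (hMsph : M ⊆ Metric.sphere (0 : X) 1) (hMcone : Convex ℝ (coneOf M))
    (A : Set X) (hAne : A.Nonempty) (hAcl : IsClosed A) (hAconv : Convex ℝ A)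
    (V : X → (X →L[ℝ] ℝ))
    (hmono : ∀ x y : X, 0 ≤ V x (x - y) - V y (x - y))
    (hhemi : ∀ x y : X, ∀ l : ℕ → ℝ, (∀ k, 0 < l k) → Tendsto l atTop (𝓝 0) →
      ∀ d : X, Tendsto (fun k => V (x + l k • y) d) atTop (𝓝 (V x d)))
    (ε : ℝ) (hε : 0 < ε) (xb : X) (hxbA : xb ∈ A) :
    ({x ∈ A | ∀ y ∈ Dset M A x,
        ((V y (x - y) : ℝ) : EReal)
          ≤ ((ENNReal.ofReal ε * minTime M y x : ℝ≥0∞) : EReal)} =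
      {x ∈ A | ∀ y ∈ Dset M A x,
        ((V x (x - y) : ℝ) : EReal)
          ≤ ((ENNReal.ofReal ε * minTime M y x : ℝ≥0∞) : EReal)}) ∧
    ({x ∈ Dset M A xb | ∀ y ∈ Dset M A xb,
        ((V y (x - y) : ℝ) : EReal)
          ≤ ((ENNReal.ofReal ε * minTime M x y : ℝ≥0∞) : EReal)} =
      {x ∈ Dset M A xb | ∀ y ∈ Dset M A xb,
        ((V x (x - y) : ℝ) : EReal)
          ≤ ((ENNReal.ofReal ε * minTime M x y : ℝ≥0∞) : EReal)}) := by
  have hz1 : ∀ (x y : X) (l : ℝ), x - (x + l • (y - x)) = l • (x - y) := by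
    intro x y l; module
  have hz2 : ∀ (x y : X) (l : ℝ), (x + l • (y - x)) - x = l • (y - x) := by
    intro x y l; module
  have hzA : ∀ x ∈ A, ∀ y ∈ A, ∀ l : ℝ, 0 < l → l ≤ 1 → x + l • (y - x) ∈ A :=
    fun x hx y hy l h0 h1 => hAconv.add_smul_sub_mem hx hy ⟨h0.le, h1⟩
  have hmono' : ∀ x y : X, ((V y (x - y) : ℝ) : EReal) ≤ ((V x (x - y) : ℝ) : EReal) := by
    intro x y
    rw [EReal.coe_le_coe_iff]
    linarith [hmono x y]
  constructor
  · ext x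
    constructor
    · rintro ⟨hx, h⟩
      refine ⟨hx, fun y hy => ?_⟩
      have hc : x - y ∈ coneOf M := (mt_ne_top hMsph).1 hy.2
      rw [mt_of_mem hMsph hc, coe_iff hε (norm_nonneg _)]
      refine limit_lem V hhemi x y _ fun l h0 h1 => ?_
      have hcz : x - (x + l • (y - x)) ∈ coneOf M := by
        rw [hz1]; exact cone_smul h0.le hc
      have := h (x + l • (y - x)) ⟨hzA x hx y hy.1 l h0 h1, (mt_ne_top hMsph).2 hcz⟩
      rw [mt_of_mem hMsph hcz, coe_iff hε (norm_nonneg _)] at this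
      refine this.trans (le_of_eq ?_)
      rw [hz1, norm_smul, Real.norm_of_nonneg h0.le]
      ring
    · rintro ⟨hx, h⟩
      exact ⟨hx, fun y hy => (hmono' x y).trans (h y hy)⟩
  · ext x
    constructor
    · rintro ⟨hx, h⟩
      refine ⟨hx, fun y hy => ?_⟩
      by_cases ht : minTime M x y = ⊤
      · rw [ht, ENNReal.mul_top (by simpa using hε)]
        simp
      have hc : y - x ∈ coneOf M := (mt_ne_top hMsph).1 ht
      rw [mt_of_mem hMsph hc, coe_iff hε (norm_nonneg _)]
      refine limit_lem V hhemi x y _ fun l h0 h1 => ?_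
      have hcz : (x + l • (y - x)) - x ∈ coneOf M := by
        rw [hz2]; exact cone_smul h0.le hc
      have hcb : xb - (x + l • (y - x)) ∈ coneOf M := by
        have := hMcone.add_smul_sub_mem ((mt_ne_top hMsph).1 hx.2) ((mt_ne_top hMsph).1 hy.2)
          (t := l) ⟨h0.le, h1⟩
        convert this using 1
        module
      have := h (x + l • (y - x)) ⟨hzA x hx.1 y hy.1 l h0 h1, (mt_ne_top hMsph).2 hcb⟩
      rw [mt_of_mem hMsph hcz, coe_iff hε (norm_nonneg _)] at this
      refine this.trans (le_of_eq ?_)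
      rw [hz2, norm_smul, Real.norm_of_nonneg h0.le]
      ring
    · rintro ⟨hx, h⟩
      exact ⟨hx, fun y hy => (hmono' x y).trans (h y hy)⟩
end
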